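/- arXiv:1801.08105 — 2 statements merged into one kernel-verified Lean document; each statement's English description precedes it below -/
import Mathlib

section
/- The function x ↦ x·exp(V₀(x))·V₀'(x) is integrable on (-∞, 0] and ∫_{-∞}^{0} x·exp(V₀(x))·V₀'(x) dx = −√2. -/
open MeasureTheory

noncomputable def V₀ (x : ℝ) : ℝ :=
  Real.log (4 * Real.exp (Real.sqrt 2 * x) / (1 + Real.exp (Real.sqrt 2 * x)) ^ 2)

lemma expV_aux (x : ℝ) : Real.exp (V₀ x) =
    4 * Real.exp (Real.sqrt 2 * x) / (1 + Real.exp (Real.sqrt 2 * x)) ^ 2 := by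
  unfold V₀
  rw [Real.exp_log (by positivity)]

lemma hasDeriv_u (x : ℝ) : HasDerivAt (fun x => Real.exp (Real.sqrt 2 * x))
    (Real.exp (Real.sqrt 2 * x) * Real.sqrt 2) x := by
  simpa using ((hasDerivAt_id x).const_mul (Real.sqrt 2)).exp

lemma hasDeriv_w (x : ℝ) : HasDerivAt
    (fun x => 4 * Real.exp (Real.sqrt 2 * x) / (1 + Real.exp (Real.sqrt 2 * x)) ^ 2)
    (4 * Real.exp (Real.sqrt 2 * x) / (1 + Real.exp (Real.sqrt 2 * x)) ^ 2 *
      (Real.sqrt 2 * (1 - Real.exp (Real.sqrt 2 * x)) / (1 + Real.exp (Real.sqrt 2 * x)))) x := by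
  have hp : 0 < 1 + Real.exp (Real.sqrt 2 * x) := by positivity
  have h := ((hasDeriv_u x).const_mul 4).div (((hasDeriv_u x).const_add 1).pow 2)
    (pow_pos hp 2).ne'
  refine h.congr_deriv ?_
  simp
  field_simp
  ring

lemma deriv_V_aux (x : ℝ) : deriv V₀ x =
    Real.sqrt 2 * (1 - Real.exp (Real.sqrt 2 * x)) / (1 + Real.exp (Real.sqrt 2 * x)) := by
  have h := (hasDeriv_w x).log (by positivity)
  have h2 : deriv V₀ x = _ := h.deriv
  rw [h2, mul_div_cancel_left₀ _ (by positivity)]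

noncomputable def G_aux (x : ℝ) : ℝ :=
  x * (4 * Real.exp (Real.sqrt 2 * x) / (1 + Real.exp (Real.sqrt 2 * x)) ^ 2) +
    2 * Real.sqrt 2 * (1 + Real.exp (Real.sqrt 2 * x))⁻¹

lemma hasDeriv_G (x : ℝ) : HasDerivAt G_aux (x * Real.exp (V₀ x) * deriv V₀ x) x := by
  have hp : 0 < 1 + Real.exp (Real.sqrt 2 * x) := by positivity
  have h := ((hasDerivAt_id x).mul (hasDeriv_w x)).add
    ((((hasDeriv_u x).const_add 1).inv hp.ne').const_mul (2 * Real.sqrt 2))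
  have hs : Real.sqrt 2 * Real.sqrt 2 = 2 := Real.mul_self_sqrt (by norm_num)
  rw [expV_aux, deriv_V_aux]
  refine h.congr_deriv ?_
  simp only [id]
  field_simp
  rw [show Real.sqrt 2 ^ 2 = 2 by rw [sq, hs]]
  ring

lemma tendsto_u : Filter.Tendsto (fun x => Real.exp (Real.sqrt 2 * x)) Filter.atBot (nhds 0) :=
  Real.tendsto_exp_atBot.comp (Filter.tendsto_id.const_mul_atBot (by positivity))

lemma tendsto_xu : Filter.Tendsto (fun x => x * Real.exp (Real.sqrt 2 * x))
    Filter.atBot (nhds 0) := by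
  have h := (Real.tendsto_pow_mul_exp_neg_atTop_nhds_zero 1).comp
    (Filter.tendsto_neg_atBot_atTop.comp
      (Filter.tendsto_id.const_mul_atBot (show 0 < Real.sqrt 2 by positivity)))
  have h2 := h.const_mul (-(Real.sqrt 2)⁻¹)
  rw [mul_zero] at h2
  refine h2.congr fun x => ?_
  simp
  field_simp

lemma tendsto_G : Filter.Tendsto G_aux Filter.atBot (nhds (2 * Real.sqrt 2)) := by
  have h1 := (tendsto_u.const_add 1)
  have h := ((tendsto_xu.const_mul 4).div (h1.pow 2) (by norm_num)).add
    ((h1.inv₀ (by norm_num)).const_mul (2 * Real.sqrt 2))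
  norm_num at h
  refine h.congr fun x => ?_
  simp [G_aux]
  ring

lemma integrable_aux :
    IntegrableOn (fun x : ℝ => x * Real.exp (V₀ x) * deriv V₀ x) (Set.Iic 0) := by
  have h : IntegrableOn (fun y : ℝ => -((-y) * Real.exp (V₀ (-y)) * deriv V₀ (-y)))
      (Set.Ioi 0) := by
    refine integrableOn_Ioi_deriv_of_nonneg' (g := fun y => G_aux (-y))
      (l := 2 * Real.sqrt 2) ?_ ?_ ?_
    · intro y _
      have := (hasDeriv_G (-y)).comp y (hasDerivAt_neg y)
      exact this.congr_deriv (by ring)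
    · intro y hy
      have hy : 0 < y := hy
      rw [deriv_V_aux]
      have : Real.exp (Real.sqrt 2 * -y) ≤ 1 := by
        rw [Real.exp_le_one_iff]
        nlinarith [Real.sqrt_nonneg 2]
      have h3 : 0 ≤ 1 - Real.exp (Real.sqrt 2 * -y) := by linarith
      have : 0 ≤ y * Real.exp (V₀ (-y)) * (Real.sqrt 2 * (1 - Real.exp (Real.sqrt 2 * -y)) /
        (1 + Real.exp (Real.sqrt 2 * -y))) := by positivity
      linarith
    · exact tendsto_G.comp Filter.tendsto_neg_atTop_atBot
  have h2 := h.neg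
  rw [integrableOn_Iic_iff_integrableOn_Iio]
  have h3 := h2.comp_neg
  simpa [Pi.neg_def] using h3

theorem stmt_7 :
    IntegrableOn (fun x : ℝ => x * Real.exp (V₀ x) * deriv V₀ x) (Set.Iic 0) ∧
    ∫ x in Set.Iic (0 : ℝ), x * Real.exp (V₀ x) * deriv V₀ x = -Real.sqrt 2 := by
  refine ⟨integrable_aux, ?_⟩
  rw [integral_Iic_of_hasDerivAt_of_tendsto' (fun x _ => hasDeriv_G x) integrable_aux tendsto_G]
  simp [G_aux]
  ring
end

section
/- For every κ, δ, e ∈ ℝ there exist a function φ : ℝ → ℝ solving φ''(x) + exp(V₀(x))·φ(x) = κ·V₀'(x) for all x ∈ ℝ, and constants C, c > 0, such that: for all x ≤ 0, |φ(x) − ( (κ/√2)·x² + 2κ·x − √2·δ·x − 2δ − e )| ≤ C·exp(c·x) and |φ'(x) − ( √2·κ·x + 2κ − √2·δ )| ≤ C·exp(c·x); and for all x ≥ 0, |φ(x) − ( −(κ/√2)·x² + 2κ·x + √2·δ·x − 2δ + e )| ≤ C·exp(−c·x) and |φ'(x) − ( −√2·κ·x + 2κ + √2·δ )| ≤ C·exp(−c·x).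 -/
noncomputable def tt (x : ℝ) : ℝ := 1 - 2 / (1 + Real.exp (Real.sqrt 2 * x))

lemma tt_pos (x : ℝ) : 0 < 1 + Real.exp (Real.sqrt 2 * x) := by positivity

lemma exp_hd (x : ℝ) : HasDerivAt (fun x : ℝ => 1 + Real.exp (Real.sqrt 2 * x))
    (Real.exp (Real.sqrt 2 * x) * Real.sqrt 2) x := by
  have h1 : HasDerivAt (fun x : ℝ => Real.sqrt 2 * x) (Real.sqrt 2) x := by
    simpa using (hasDerivAt_id x).const_mul (Real.sqrt 2)
  exact (h1.exp).const_add 1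

lemma tt_hd (x : ℝ) : HasDerivAt tt (Real.sqrt 2 / 2 * (1 - tt x ^ 2)) x := by
  have h := ((hasDerivAt_const x (2 : ℝ)).div (exp_hd x) (tt_pos x).ne').const_sub 1
  refine HasDerivAt.congr_deriv (f := tt) h ?_
  have := (tt_pos x).ne'
  unfold tt
  field_simp
  ring

lemma exp_V (x : ℝ) : Real.exp (V₀ x) = 1 - tt x ^ 2 := by
  unfold V₀
  rw [Real.exp_log (by positivity)]
  have := (tt_pos x).ne'
  unfold tt
  field_simp
  ring

lemma V_hd (x : ℝ) : HasDerivAt V₀ (-(Real.sqrt 2) * tt x) x := by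
  have hV : V₀ = fun x => Real.log 4 + Real.sqrt 2 * x
      - 2 * Real.log (1 + Real.exp (Real.sqrt 2 * x)) := by
    funext y
    unfold V₀
    have := (tt_pos y).ne'
    rw [Real.log_div (by positivity) (by positivity), Real.log_mul (by positivity) (by positivity),
      Real.log_exp, Real.log_pow]
    norm_num
  rw [hV]
  have h1 : HasDerivAt (fun x : ℝ => Real.sqrt 2 * x) (Real.sqrt 2) x := by
    simpa using (hasDerivAt_id x).const_mul (Real.sqrt 2)
  have h := (h1.const_add (Real.log 4)).sub
    (((exp_hd x).log (tt_pos x).ne').const_mul 2)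
  refine HasDerivAt.congr_deriv h ?_
  have := (tt_pos x).ne'
  unfold tt
  field_simp
  ring

lemma one_le_sqrt2 : 1 ≤ Real.sqrt 2 := Real.one_le_sqrt.mpr (by norm_num)

lemma sqrt2_le : Real.sqrt 2 ≤ 2 := by
  rw [Real.sqrt_le_left (by norm_num)]; norm_num

lemma tt_lt (x : ℝ) : tt x ≤ 1 ∧ -1 ≤ tt x := by
  have h := tt_pos x
  have he := Real.exp_pos (Real.sqrt 2 * x)
  unfold tt
  constructor
  · have : 0 ≤ 2 / (1 + Real.exp (Real.sqrt 2 * x)) := by positivity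
    linarith
  · have : 2 / (1 + Real.exp (Real.sqrt 2 * x)) ≤ 2 := by
      rw [div_le_iff₀ h]; linarith
    linarith

lemma tt_right (x : ℝ) (hx : 0 ≤ x) : 1 - tt x ≤ 2 * Real.exp (-x) := by
  have h := tt_pos x
  have h1 : Real.exp x ≤ Real.exp (Real.sqrt 2 * x) :=
    Real.exp_le_exp.mpr (by nlinarith [one_le_sqrt2])
  have h2 : Real.exp (-x) * Real.exp x = 1 := by rw [← Real.exp_add]; simp
  have : 2 / (1 + Real.exp (Real.sqrt 2 * x)) ≤ 2 * Real.exp (-x) := by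
    rw [div_le_iff₀ h]
    nlinarith [Real.exp_pos (-x)]
  unfold tt
  linarith

lemma tt_left (x : ℝ) (hx : x ≤ 0) : 1 + tt x ≤ 2 * Real.exp x := by
  have h := tt_pos x
  have h0 := Real.exp_pos (Real.sqrt 2 * x)
  have h1 : Real.exp (Real.sqrt 2 * x) ≤ Real.exp x :=
    Real.exp_le_exp.mpr (by nlinarith [one_le_sqrt2])
  have : 1 + tt x = 2 * Real.exp (Real.sqrt 2 * x) / (1 + Real.exp (Real.sqrt 2 * x)) := by
    unfold tt; field_simp; ring
  rw [this, div_le_iff₀ h]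
  nlinarith [Real.exp_pos x]

lemma quad_bound (A B D : ℝ) (x y : ℝ) (hy : 0 ≤ y) (hxy : |x| = 2 * y) :
    |A * x ^ 2 + B * x + D| ≤ (8 * |A| + 2 * |B| + |D|) * Real.exp y := by
  have h1 := Real.quadratic_le_exp_of_nonneg hy
  calc |A * x ^ 2 + B * x + D| ≤ |A * x ^ 2| + |B * x| + |D| := abs_add_three _ _ _
    _ = |A| * (4 * y ^ 2) + |B| * (2 * y) + |D| := by
        rw [abs_mul, abs_mul, abs_pow, hxy]; ring
    _ ≤ |A| * (8 * Real.exp y) + |B| * (2 * Real.exp y) + |D| * Real.exp y := by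
        have e1 : |A| * (4 * y ^ 2) ≤ |A| * (8 * Real.exp y) :=
          mul_le_mul_of_nonneg_left (by nlinarith) (abs_nonneg A)
        have e2 : |B| * (2 * y) ≤ |B| * (2 * Real.exp y) :=
          mul_le_mul_of_nonneg_left (by nlinarith) (abs_nonneg B)
        have e3 : |D| * 1 ≤ |D| * Real.exp y :=
          mul_le_mul_of_nonneg_left (by nlinarith) (abs_nonneg D)
        linarith
    _ = _ := by ring

lemma final_bound (r s P Q M N y : ℝ) (hr : |r| ≤ 2 * Real.exp (-(2 * y)))
    (hs : |s| ≤ 4 * Real.exp (-(2 * y))) (hP : |P| ≤ M * Real.exp y)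
    (hQ : |Q| ≤ N * Real.exp y) (hM : 0 ≤ M) (hN : 0 ≤ N) :
    |r * P| ≤ (4 * M + 2 * N + 1) * Real.exp (-y) ∧
    |s * P + r * Q| ≤ (4 * M + 2 * N + 1) * Real.exp (-y) := by
  have hE : Real.exp (-(2 * y)) * Real.exp y = Real.exp (-y) := by
    rw [← Real.exp_add]; congr 1; ring
  have hp := Real.exp_pos (-y)
  have a1 : |r * P| ≤ 2 * M * Real.exp (-y) := by
    rw [abs_mul, ← hE]
    calc |r| * |P| ≤ (2 * Real.exp (-(2 * y))) * (M * Real.exp y) := by gcongr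
      _ = _ := by ring
  have a2 : |s * P| ≤ 4 * M * Real.exp (-y) := by
    rw [abs_mul, ← hE]
    calc |s| * |P| ≤ (4 * Real.exp (-(2 * y))) * (M * Real.exp y) := by gcongr
      _ = _ := by ring
  have a3 : |r * Q| ≤ 2 * N * Real.exp (-y) := by
    rw [abs_mul, ← hE]
    calc |r| * |Q| ≤ (2 * Real.exp (-(2 * y))) * (N * Real.exp y) := by gcongr
      _ = _ := by ring
  have m1 : 0 ≤ M * Real.exp (-y) := by positivity
  have m2 : 0 ≤ N * Real.exp (-y) := by positivity
  constructor
  · nlinarith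
  · have := abs_add_le (s * P) (r * Q)
    nlinarith

theorem stmt_12 (κ δ e : ℝ) :
    ∃ φ : ℝ → ℝ, ∃ C > 0, ∃ c > 0,
      (∀ x : ℝ, deriv (deriv φ) x + Real.exp (V₀ x) * φ x = κ * deriv V₀ x) ∧
      (∀ x ≤ (0 : ℝ),
        |φ x - (κ / Real.sqrt 2 * x ^ 2 + 2 * κ * x - Real.sqrt 2 * δ * x - 2 * δ - e)|
          ≤ C * Real.exp (c * x) ∧
        |deriv φ x - (Real.sqrt 2 * κ * x + 2 * κ - Real.sqrt 2 * δ)|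
          ≤ C * Real.exp (c * x)) ∧
      (∀ x ≥ (0 : ℝ),
        |φ x - (-(κ / Real.sqrt 2) * x ^ 2 + 2 * κ * x + Real.sqrt 2 * δ * x - 2 * δ + e)|
          ≤ C * Real.exp (-c * x) ∧
        |deriv φ x - (-(Real.sqrt 2) * κ * x + 2 * κ + Real.sqrt 2 * δ)|
          ≤ C * Real.exp (-c * x)) := by

  have ha2 : Real.sqrt 2 ^ 2 = 2 := Real.sq_sqrt (by norm_num)
  have ha1 := one_le_sqrt2
  have hale := sqrt2_le
  have hkd : κ / Real.sqrt 2 = Real.sqrt 2 * κ / 2 := by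
    field_simp; rw [ha2]
  rw [hkd]
  have V_hd' : ∀ x, deriv V₀ x = -(Real.sqrt 2) * tt x := fun x => (V_hd x).deriv
  simp only [V_hd', exp_V]
  set a := Real.sqrt 2 with ha
  let P : ℝ → ℝ := fun x => (-(a * κ / 2)) * x ^ 2 + (a * δ) * x + e
  let Q : ℝ → ℝ := fun x => 0 * x ^ 2 + (-(a * κ)) * x + a * δ
  have hP : ∀ x, HasDerivAt P (Q x) x := by
    intro x
    have h := ((((hasDerivAt_id x).pow 2).const_mul (-(a * κ / 2))).add
      ((hasDerivAt_id x).const_mul (a * δ))).add_const e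
    refine HasDerivAt.congr_deriv (f := P) h ?_
    simp [Q]; ring
  have hQ : ∀ x, HasDerivAt Q (-(a * κ)) x := by
    intro x
    have h := ((((hasDerivAt_id x).pow 2).const_mul 0).add
      ((hasDerivAt_id x).const_mul (-(a * κ)))).add_const (a * δ)
    refine HasDerivAt.congr_deriv (f := Q) h ?_
    simp
  let φ : ℝ → ℝ := fun x => tt x * P x + (2 * κ * x - 2 * δ)
  have hlin : ∀ x, HasDerivAt (fun x : ℝ => 2 * κ * x - 2 * δ) (2 * κ) x := by
    intro x
    simpa using ((hasDerivAt_id x).const_mul (2 * κ)).sub_const (2 * δ)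
  have hφ : deriv φ = fun x => a / 2 * (1 - tt x ^ 2) * P x + tt x * Q x + 2 * κ := by
    funext x
    exact (((tt_hd x).mul (hP x)).add (hlin x)).deriv
  have hφ2 : ∀ x, deriv (deriv φ) x = -(1 - tt x ^ 2) * tt x * P x
      + a * (1 - tt x ^ 2) * Q x - a * κ * tt x := by
    intro x
    rw [hφ]
    have h := ((((((tt_hd x).pow 2).const_sub 1).const_mul (a / 2)).mul (hP x)).add
      ((tt_hd x).mul (hQ x))).add_const (2 * κ)
    refine (HasDerivAt.congr_deriv h ?_).deriv
    simp only [← ha, Pi.pow_apply]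
    push_cast
    linear_combination (-(tt x * (1 - tt x ^ 2) * P x) / 2) * ha2
  let M := 8 * |-(a * κ / 2)| + 2 * |a * δ| + |e|
  let N := 8 * |(0 : ℝ)| + 2 * |-(a * κ)| + |a * δ|
  have hM : 0 ≤ M := by positivity
  have hN : 0 ≤ N := by positivity
  refine ⟨φ, 4 * M + 2 * N + 1, by positivity, 1 / 2, by norm_num, ?_, ?_, ?_⟩
  · intro x
    rw [hφ2]
    simp only [φ, Q]
    linear_combination (1 - tt x ^ 2) * (-κ * x + δ) * ha2
  · intro x hx
    obtain ⟨t1, t2⟩ := tt_lt x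
    have tl := tt_left x hx
    have hxy : |x| = 2 * (-(x / 2)) := by rw [abs_of_nonpos hx]; ring
    have hy : 0 ≤ -(x / 2) := by linarith
    have hee : Real.exp (-(2 * (-(x / 2)))) = Real.exp x := by congr 1; ring
    have hd : 0 ≤ a / 2 * (1 - tt x ^ 2) := by
      have : 0 ≤ 1 - tt x ^ 2 := by nlinarith
      positivity
    have key := final_bound (tt x + 1) (a / 2 * (1 - tt x ^ 2)) (P x) (Q x) M N (-(x / 2))
      (by rw [hee, abs_of_nonneg (by linarith)]; linarith)
      (by
        rw [hee, abs_of_nonneg hd]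
        have : 1 - tt x ^ 2 ≤ 2 * (1 + tt x) := by nlinarith
        have : 0 ≤ 1 - tt x ^ 2 := by nlinarith
        nlinarith)
      (quad_bound _ _ _ x _ hy hxy) (quad_bound _ _ _ x _ hy hxy) hM hN
    have he : -(-(x / 2)) = 1 / 2 * x := by ring
    rw [he] at key
    constructor
    · convert key.1 using 2
      simp only [φ, P]; ring
    · convert key.2 using 2
      rw [hφ]; simp only [P, Q]; ring
  · intro x hx
    obtain ⟨t1, t2⟩ := tt_lt x
    have tl := tt_right x hx
    have hxy : |x| = 2 * (x / 2) := by rw [abs_of_nonneg hx]; ring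
    have hy : 0 ≤ x / 2 := by linarith
    have hee : Real.exp (-(2 * (x / 2))) = Real.exp (-x) := by congr 1; ring
    have hd : 0 ≤ a / 2 * (1 - tt x ^ 2) := by
      have : 0 ≤ 1 - tt x ^ 2 := by nlinarith
      positivity
    have key := final_bound (tt x - 1) (a / 2 * (1 - tt x ^ 2)) (P x) (Q x) M N (x / 2)
      (by rw [hee, abs_of_nonpos (by linarith)]; linarith)
      (by
        rw [hee, abs_of_nonneg hd]
        have : 1 - tt x ^ 2 ≤ 2 * (1 - tt x) := by nlinarith
        have : 0 ≤ 1 - tt x ^ 2 := by nlinarith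
        nlinarith)
      (quad_bound _ _ _ x _ hy hxy) (quad_bound _ _ _ x _ hy hxy) hM hN
    have he : -(x / 2) = -(1 / 2) * x := by ring
    rw [he] at key
    constructor
    · convert key.1 using 2
      simp only [φ, P]; ring
    · convert key.2 using 2
      rw [hφ]; simp only [P, Q]; ring
end
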